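/- Offline value decomposition: for any strategy b ∈ 𝒫*_{≤m} determined by 0 < Q_1 < … < Q_ℓ ≤ M (with ℓ ≤ m) and any competing-bid profile β₋, V(b;β₋) = ∑_{j=1}^{ℓ} ∑_{k=Q_{j−1}+1}^{Q_j} v_k · 1{w_{Q_j} ≥ β₋^{-(k)}}. Consequently, for any bid history H₋ = (β₋^1,…,β₋^T), max_{b ∈ 𝒫*_{≤m}} ∑_{t=1}^{T} V(b;β₋^t) = max_{ℓ ∈ {1,…,m}} max_{0 < Q_1 < … < Q_ℓ ≤ M} ∑_{j=1}^{ℓ} ∑_{t=1}^{T} ∑_{k=Q_{j−1}+1}^{Q_j} v_k · 1{w_{Q_j} ≥ (β₋^t)^{-(k)}}. -/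

import Mathlib

open Finset

namespace Auction

/-- A competing-bid profile for an auction of `K` identical units, represented by the
function sending `j ∈ {1,…,K}` to the `j`-th smallest element of the multiset of the
`K` largest competing bids. -/
structure Profile (K : ℕ) where
  c : ℕ → ℝ
  mono : ∀ i j : ℕ, 1 ≤ i → i ≤ j → j ≤ K → c i ≤ c j
  nonneg : ∀ j : ℕ, 1 ≤ j → j ≤ K → 0 ≤ c j

/-- A bid vector: `n` units are demanded and `bid j` is the bid for the `j`-th unit
(for `1 ≤ j ≤ n`). -/
structure BidVec where
  n : ℕ
  bid : ℕ → ℝ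

/-- A bid vector is valid if its bids are non-increasing and positive. -/
def BidVec.Valid (b : BidVec) : Prop :=
  (∀ i j : ℕ, 1 ≤ i → i ≤ j → j ≤ b.n → b.bid j ≤ b.bid i) ∧
  ∀ j : ℕ, 1 ≤ j → j ≤ b.n → 0 < b.bid j

open Classical in
/-- The number of units the bidder wins (ties broken in the bidder's favor): the
largest `r ≤ min n K` such that the bidder's `j`-th bid is at least the `j`-th
threshold `β.c j` for every `j ≤ r`. -/
noncomputable def alloc (K : ℕ) (b : BidVec) (β : Profile K) : ℕ :=
  ((Finset.Icc 1 (min b.n K)).filter fun r => ∀ j ∈ Finset.Icc 1 r, β.c j ≤ b.bid j).sup id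

/-- The clearing price: the `K`-th highest among all submitted bids (taken to be `0`
when the bidder wins no unit). -/
noncomputable def price (K : ℕ) (b : BidVec) (β : Profile K) : ℝ :=
  if alloc K b β = 0 then 0
  else if alloc K b β < K then min (b.bid (alloc K b β)) (β.c (alloc K b β + 1))
  else b.bid K

/-- The value obtained by the bidder. -/
noncomputable def value (v : ℕ → ℝ) (K : ℕ) (b : BidVec) (β : Profile K) : ℝ :=
  ∑ j ∈ Finset.Icc 1 (alloc K b β), v j

/-- The bidder's total payment. -/
noncomputable def payment (K : ℕ) (b : BidVec) (β : Profile K) : ℝ :=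
  price K b β * (alloc K b β : ℝ)

/-- The RoI constraint (with target RoI `γ = 0`) against a single competing-bid profile. -/
def Feasible (v : ℕ → ℝ) (K : ℕ) (b : BidVec) (β : Profile K) : Prop :=
  payment K b β ≤ value v K b β

/-- A bid vector is safe if it satisfies the RoI constraint against every profile. -/
def Safe (v : ℕ → ℝ) (K : ℕ) (b : BidVec) : Prop :=
  ∀ β : Profile K, Feasible v K b β

/-- A valuation vector: nonnegative and non-increasing on `{1,…,M}`. -/
def ValidValuation (M : ℕ) (v : ℕ → ℝ) : Prop :=
  (∀ j : ℕ, 1 ≤ j → j ≤ M → 0 ≤ v j) ∧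
  ∀ i j : ℕ, 1 ≤ i → i ≤ j → j ≤ M → v j ≤ v i

/-- The average cumulative valuation `w_j = (v_1 + ⋯ + v_j) / j`. -/
noncomputable def w (v : ℕ → ℝ) (j : ℕ) : ℝ :=
  (∑ ℓ ∈ Finset.Icc 1 j, v ℓ) / (j : ℝ)

/-- An `m`-uniform bidding strategy: bid-quantity pairs `(b j, q j)` for `1 ≤ j ≤ m`. -/
structure Uniform where
  m : ℕ
  b : ℕ → ℝ
  q : ℕ → ℕ

/-- Cumulative quantities `Q j = q 1 + ⋯ + q j`. -/
def Uniform.Q (s : Uniform) (j : ℕ) : ℕ := ∑ ℓ ∈ Finset.Icc 1 j, s.q ℓ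

/-- `s` is a genuine `m`-uniform strategy for maximum demand `M`:
`b 1 > b 2 > ⋯ > b m > 0`, positive quantities, and `Q m ≤ M`. -/
def Uniform.IsUniform (M : ℕ) (s : Uniform) : Prop :=
  1 ≤ s.m ∧
  (∀ j : ℕ, 1 ≤ j → j ≤ s.m → 0 < s.q j) ∧
  0 < s.b s.m ∧
  (∀ j : ℕ, 1 ≤ j → j < s.m → s.b (j + 1) < s.b j) ∧
  s.Q s.m ≤ M

/-- The bid vector associated to a uniform strategy: the bid on the `j`-th unit is
`b ℓ`, where `ℓ` is least with `j ≤ Q ℓ`. -/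
noncomputable def Uniform.toBidVec (s : Uniform) : BidVec :=
  ⟨s.Q s.m, fun j => s.b (sInf {ℓ : ℕ | j ≤ s.Q ℓ})⟩

/-- The 1-uniform strategy bidding `b` on `q` units. -/
def single (b : ℝ) (q : ℕ) : Uniform := ⟨1, fun _ => b, fun _ => q⟩

/-- Membership in the class `𝒫*_{≤ m}` of safe undominated strategies with at most `m`
bid-quantity pairs: strategies determined by a tuple `0 < Q 1 < ⋯ < Q k ≤ M` (`k ≤ m`)
via `b ℓ = w (Q ℓ)` and `q ℓ = Q ℓ - Q (ℓ-1)`. -/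
def InSafeClass (M : ℕ) (v : ℕ → ℝ) (m : ℕ) (s : Uniform) : Prop :=
  1 ≤ s.m ∧ s.m ≤ m ∧ (∀ j : ℕ, 1 ≤ j → j ≤ s.m → 0 < s.q j) ∧ s.Q s.m ≤ M ∧
  ∀ ℓ : ℕ, 1 ≤ ℓ → ℓ ≤ s.m → s.b ℓ = w v (s.Q ℓ)

/-- Membership in the class `𝒬_{≤ m}(H)` of strategies with at most `m` bid-quantity
pairs that are RoI-feasible for the bid history `H` over rounds `1,…,T`. -/
def InFeasClass (M : ℕ) (v : ℕ → ℝ) (K T : ℕ) (H : ℕ → Profile K) (m : ℕ) (s : Uniform) : Prop :=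
  s.IsUniform M ∧ s.m ≤ m ∧ ∀ t ∈ Finset.Icc 1 T, Feasible v K s.toBidVec (H t)

/-- Total value obtained by strategy `s` over the bid history `H` on rounds `1,…,T`. -/
noncomputable def totalValue (v : ℕ → ℝ) (K T : ℕ) (H : ℕ → Profile K) (s : Uniform) : ℝ :=
  ∑ t ∈ Finset.Icc 1 T, value v K s.toBidVec (H t)

/-- The optimal total value over the class `𝒫*_{≤ m}`. -/
noncomputable def bestSafe (M : ℕ) (v : ℕ → ℝ) (K T : ℕ) (H : ℕ → Profile K) (m : ℕ) : ℝ :=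
  sSup {x : ℝ | ∃ s : Uniform, InSafeClass M v m s ∧ x = totalValue v K T H s}

/-- The optimal total value over the class `𝒬_{≤ m}(H)`. -/
noncomputable def bestFeas (M : ℕ) (v : ℕ → ℝ) (K T : ℕ) (H : ℕ → Profile K) (m : ℕ) : ℝ :=
  sSup {x : ℝ | ∃ s : Uniform, InFeasClass M v K T H m s ∧ x = totalValue v K T H s}

/-- The average cumulative valuation is non-increasing. -/
theorem w_antitone {M : ℕ} {v : ℕ → ℝ} (hv : ValidValuation M v) {i j : ℕ}
    (hi : 1 ≤ i) (hij : i ≤ j) (hj : j ≤ M) : w v j ≤ w v i := by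
  induction j, hij using Nat.le_induction with
  | base => exact le_rfl
  | succ j hij ih =>
    refine le_trans ?_ (ih (by omega))
    have hj0 : (0 : ℝ) < j := by exact_mod_cast (by omega : 0 < j)
    have hcard : (j : ℝ) * v (j + 1) ≤ ∑ ℓ ∈ Finset.Icc 1 j, v ℓ := by
      have h := Finset.card_nsmul_le_sum (Finset.Icc 1 j) v (v (j + 1)) fun ℓ hℓ => by
        rw [Finset.mem_Icc] at hℓ
        exact hv.2 ℓ (j + 1) hℓ.1 (by omega) hj
      simpa [nsmul_eq_mul] using h
    unfold w
    rw [Finset.sum_Icc_succ_top (by omega), div_le_div_iff₀ (by positivity) hj0]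
    push_cast
    linarith

/-- For non-increasing bids, the bidder obtains the value of exactly those units whose
bid meets the corresponding threshold. -/
theorem value_eq_sum_ite {K : ℕ} (v : ℕ → ℝ) (b : BidVec) (β : Profile K) (hn : b.n ≤ K)
    (hb : ∀ i j : ℕ, 1 ≤ i → i ≤ j → j ≤ b.n → b.bid j ≤ b.bid i) :
    value v K b β = ∑ k ∈ Finset.Icc 1 b.n, if β.c k ≤ b.bid k then v k else 0 := by
  classical
  rw [value, ← Finset.sum_filter]
  congr 1
  ext k
  simp only [alloc, min_eq_left hn, Finset.mem_Icc, Finset.mem_filter]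
  constructor
  · rintro ⟨hk, hle⟩
    obtain ⟨r, hr, hkr⟩ := (Finset.le_sup_iff (by exact hk)).1 hle
    simp only [Finset.mem_filter, Finset.mem_Icc, id] at hr hkr
    exact ⟨⟨hk, hkr.trans hr.1.2⟩, hr.2 k ⟨hk, hkr⟩⟩
  · rintro ⟨⟨hk, hkn⟩, hc⟩
    refine ⟨hk, Finset.le_sup (f := id) ?_⟩
    simp only [Finset.mem_filter, Finset.mem_Icc]
    exact ⟨⟨hk, hkn⟩, fun j hj => (β.mono j k hj.1 hj.2 (hkn.trans hn)).trans
      (hc.trans (hb j k hj.1 hj.2 hkn))⟩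

theorem Uniform.Q_mono (s : Uniform) : Monotone s.Q := fun _ _ h =>
  Finset.sum_le_sum_of_subset (Finset.Icc_subset_Icc_right h)

/-- The index of the bid-quantity pair covering unit `k` is the `j` with
`Q (j - 1) < k ≤ Q j`. -/
theorem Uniform.toBidVec_bid_eq (s : Uniform) {j k : ℕ} (h₁ : s.Q (j - 1) < k) (h₂ : k ≤ s.Q j) :
    s.toBidVec.bid k = s.b j := by
  refine congrArg s.b (le_antisymm (Nat.sInf_le h₂) (le_csInf ⟨j, h₂⟩ fun ℓ hℓ => ?_))
  by_contra! h
  exact absurd (h₁.trans_le hℓ) (s.Q_mono (by omega)).not_gt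

/-- The intervals `(Q (j - 1), Q j]` partition `{1, …, Q n}`. -/
theorem Uniform.sum_Icc_Q (s : Uniform) (f : ℕ → ℝ) (n : ℕ) :
    ∑ k ∈ Finset.Icc 1 (s.Q n), f k =
      ∑ j ∈ Finset.Icc 1 n, ∑ k ∈ Finset.Icc (s.Q (j - 1) + 1) (s.Q j), f k := by
  induction n with
  | zero => simp [Uniform.Q]
  | succ n ih =>
    rw [Finset.sum_Icc_succ_top (by omega), ← ih, Nat.add_sub_cancel]
    have h : s.Q n ≤ s.Q (n + 1) := s.Q_mono (by omega)
    rw [← Finset.sum_union]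
    · congr 1
      ext k
      simp only [Finset.mem_union, Finset.mem_Icc]
      omega
    · rw [Finset.disjoint_left]
      intro k
      simp only [Finset.mem_Icc]
      omega

/-- Every unit `k ≤ Q n` is covered by some bid-quantity pair `j ≤ n`. -/
theorem Uniform.exists_Q_pred_lt_le (s : Uniform) {n k : ℕ} (hk : 1 ≤ k) (hkn : k ≤ s.Q n) :
    ∃ j, 1 ≤ j ∧ j ≤ n ∧ s.Q (j - 1) < k ∧ k ≤ s.Q j := by
  induction n with
  | zero => simp [Uniform.Q] at hkn; omega
  | succ n ih =>
    rcases le_or_gt k (s.Q n) with h | h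
    · obtain ⟨j, h₁, h₂, h₃⟩ := ih h
      exact ⟨j, h₁, h₂.trans n.le_succ, h₃⟩
    · exact ⟨n + 1, by omega, le_rfl, h, hkn⟩

/-- The bid vector of a safe undominated strategy is non-increasing. -/
theorem InSafeClass.toBidVec_antitone {M m : ℕ} {v : ℕ → ℝ} {s : Uniform}
    (hv : ValidValuation M v) (hs : InSafeClass M v m s) (i j : ℕ) (hi : 1 ≤ i) (hij : i ≤ j)
    (hj : j ≤ s.toBidVec.n) : s.toBidVec.bid j ≤ s.toBidVec.bid i := by
  obtain ⟨-, -, -, hM, hb⟩ := hs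
  obtain ⟨a, ha, ham, ha₁, ha₂⟩ := s.exists_Q_pred_lt_le hi (hij.trans hj)
  obtain ⟨c, hc, hcm, hc₁, hc₂⟩ := s.exists_Q_pred_lt_le (hi.trans hij) hj
  rw [s.toBidVec_bid_eq ha₁ ha₂, s.toBidVec_bid_eq hc₁ hc₂, hb a ha ham, hb c hc hcm]
  have hac : a ≤ c := by
    by_contra! h
    have := s.Q_mono (show c ≤ a - 1 by omega)
    omega
  exact w_antitone hv (hi.trans ha₂) (s.Q_mono hac) ((s.Q_mono hcm).trans hM)

/-- Lemma `lem:decomp`, offline value decomposition: for a strategy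
`b ∈ 𝒫*_{≤ m}` determined by `0 < Q 1 < ⋯ < Q ℓ ≤ M`,
`V(b;β) = ∑_{j=1}^{ℓ} ∑_{k=Q (j-1)+1}^{Q j} v k · 1{w (Q j) ≥ β^{-(k)}}`, and
consequently the total value over any bid history decomposes accordingly. -/
theorem offline_value_decomposition
    (K M : ℕ) (v : ℕ → ℝ) (hv : ValidValuation M v) (hMK : M ≤ K)
    (m : ℕ) (s : Uniform) (hs : InSafeClass M v m s) :
    (∀ β : Profile K,
      value v K s.toBidVec β =
        ∑ j ∈ Finset.Icc 1 s.m, ∑ k ∈ Finset.Icc (s.Q (j - 1) + 1) (s.Q j),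
          if β.c k ≤ w v (s.Q j) then v k else 0) ∧
    (∀ (T : ℕ) (H : ℕ → Profile K),
      totalValue v K T H s =
        ∑ j ∈ Finset.Icc 1 s.m, ∑ t ∈ Finset.Icc 1 T,
          ∑ k ∈ Finset.Icc (s.Q (j - 1) + 1) (s.Q j),
            if (H t).c k ≤ w v (s.Q j) then v k else 0) := by
  have hvalue : ∀ β : Profile K,
      value v K s.toBidVec β =
        ∑ j ∈ Finset.Icc 1 s.m, ∑ k ∈ Finset.Icc (s.Q (j - 1) + 1) (s.Q j),
          if β.c k ≤ w v (s.Q j) then v k else 0 := by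
    intro β
    have hanti := InSafeClass.toBidVec_antitone hv hs
    obtain ⟨-, -, -, hM, hb⟩ := hs
    rw [value_eq_sum_ite v s.toBidVec β (hM.trans hMK) hanti]
    refine (s.sum_Icc_Q _ s.m).trans ?_
    refine Finset.sum_congr rfl fun j hj => Finset.sum_congr rfl fun k hk => ?_
    rw [Finset.mem_Icc] at hj hk
    rw [s.toBidVec_bid_eq hk.1 hk.2, hb j hj.1 hj.2]
  refine ⟨hvalue, fun T H => ?_⟩
  rw [totalValue, Finset.sum_comm]
  exact Finset.sum_congr rfl fun t _ => hvalue (H t)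

end Auction
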